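/- arXiv:1407.6698 — 2 statements merged into one kernel-verified Lean document; each statement's English description precedes it below -/
import Mathlib

section
/- Let n ≥ 1 and let B be a symmetric bilinear form on ℝⁿ that is positive definite and takes integer values on ℤⁿ. Fix an integer k ≥ 1 and τ ∈ ℍ. Then the function h ↦ θ_k(τ, h) is complex differentiable (holomorphic) at every point of ℂⁿ. -/
noncomputable section

/-- An integer vector viewed inside `ℂⁿ`. -/
def zc {n : ℕ} (β : Fin n → ℤ) : Fin n → ℂ := fun i => (β i : ℂ)

/-- A real vector viewed inside `ℂⁿ`. -/
def rc {n : ℕ} (x : Fin n → ℝ) : Fin n → ℂ := fun i => (x i : ℂ)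

/-- The `β`-th term of the level `k` theta series:
`exp(2πik·B(β, h) + πik·τ·B(β, β))`. -/
def thetaTerm {n : ℕ} (B : (Fin n → ℂ) →ₗ[ℂ] (Fin n → ℂ) →ₗ[ℂ] ℂ)
    (k : ℤ) (τ : ℂ) (h : Fin n → ℂ) (β : Fin n → ℤ) : ℂ :=
  Complex.exp (2 * (Real.pi : ℂ) * Complex.I * (k : ℂ) * B (zc β) h
    + (Real.pi : ℂ) * Complex.I * (k : ℂ) * τ * B (zc β) (zc β))

/-- The level `k` theta function `θ_k(τ, h) = Σ_{β ∈ ℤⁿ} exp(2πik·B(β, h) + πik·τ·B(β, β))`. -/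
def theta {n : ℕ} (B : (Fin n → ℂ) →ₗ[ℂ] (Fin n → ℂ) →ₗ[ℂ] ℂ)
    (k : ℤ) (τ : ℂ) (h : Fin n → ℂ) : ℂ :=
  ∑' β : Fin n → ℤ, thetaTerm B k τ h β

/-- A product of nonnegative summable functions of the separate coordinates is summable. -/
theorem summable_prod_apply {α : Type*} {g : α → ℝ} (hg0 : ∀ a, 0 ≤ g a) (hg : Summable g)
    (n : ℕ) : Summable fun β : Fin n → α => ∏ i, g (β i) := by
  induction n with
  | zero => exact Summable.of_finite
  | succ n ih =>
    rw [← (Fin.consEquiv fun _ : Fin (n + 1) => α).summable_iff]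
    have key := hg.mul_of_nonneg ih hg0 fun β => Finset.prod_nonneg fun i _ => hg0 (β i)
    refine key.congr fun p => ?_
    simp [Fin.prod_univ_succ, Fin.consEquiv]

/-- One-dimensional Gaussian sums over `ℤ` with a linear perturbation converge. -/
theorem summable_exp_linear_sub_sq (K : ℝ) {c : ℝ} (hc : 0 < c) :
    Summable fun m : ℤ => Real.exp (K * |(m : ℝ)| - c * (m : ℝ) ^ 2) := by
  have h := summable_pow_mul_jacobiTheta₂_term_bound (K / (2 * Real.pi))
    (div_pos hc Real.pi_pos) 0
  refine h.congr fun m => ?_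
  have := Real.pi_ne_zero
  simp only [pow_zero, one_mul, Int.cast_abs]
  congr 1
  field_simp
  ring

/-- A positive definite real bilinear form dominates a multiple of the sum of squares. -/
theorem exists_pos_mul_sum_sq_le {n : ℕ} (Q : (Fin n → ℝ) →ₗ[ℝ] (Fin n → ℝ) →ₗ[ℝ] ℝ)
    (hQ : ∀ x : Fin n → ℝ, x ≠ 0 → 0 < Q x x) :
    ∃ c : ℝ, 0 < c ∧ ∀ x : Fin n → ℝ, c * ∑ i, x i ^ 2 ≤ Q x x := by
  rcases Nat.eq_zero_or_pos n with rfl | hn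
  · exact ⟨1, one_pos, fun x => by
      rw [Subsingleton.elim x 0, map_zero]
      simp⟩
  have : Nonempty (Fin n) := ⟨⟨0, hn⟩⟩
  have hn' : (0 : ℝ) < n := by exact_mod_cast hn
  have hcont : Continuous fun x : Fin n → ℝ => Q x x := by
    have h : Continuous fun x : Fin n → ℝ => LinearMap.toContinuousLinearMap (Q x) :=
      (LinearMap.toContinuousLinearMap.toLinearMap ∘ₗ Q).continuous_of_finiteDimensional
    exact h.clm_apply continuous_id
  obtain ⟨v, hv, hmin⟩ := (isCompact_sphere (0 : Fin n → ℝ) 1).exists_isMinOn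
    (NormedSpace.sphere_nonempty.2 zero_le_one) hcont.continuousOn
  have hv0 : v ≠ 0 := by
    rintro rfl
    simp at hv
  refine ⟨Q v v / n, div_pos (hQ v hv0) hn', fun x => ?_⟩
  rcases eq_or_ne x 0 with rfl | hx
  · simp
  have hx' : 0 < ‖x‖ := norm_pos_iff.2 hx
  have hsum : ∑ i, x i ^ 2 ≤ n * ‖x‖ ^ 2 := by
    calc ∑ i, x i ^ 2 ≤ ∑ _i : Fin n, ‖x‖ ^ 2 := Finset.sum_le_sum fun i _ => by
          rw [← sq_abs]
          exact pow_le_pow_left₀ (abs_nonneg _) (norm_le_pi_norm x i) 2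
      _ = n * ‖x‖ ^ 2 := by simp
  have hle : Q v v ≤ Q (‖x‖⁻¹ • x) (‖x‖⁻¹ • x) :=
    hmin (by simp [norm_smul, hx'.ne'])
  have hscale : Q x x = ‖x‖ ^ 2 * Q (‖x‖⁻¹ • x) (‖x‖⁻¹ • x) := by
    simp only [map_smul, LinearMap.smul_apply, smul_eq_mul]
    field_simp
  calc Q v v / n * ∑ i, x i ^ 2 ≤ Q v v / n * (n * ‖x‖ ^ 2) :=
        mul_le_mul_of_nonneg_left hsum (div_pos (hQ v hv0) hn').le
    _ = ‖x‖ ^ 2 * Q v v := by field_simp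
    _ ≤ Q x x := by
        rw [hscale]
        gcongr

/-- The functionals `B (zc β)` grow at most linearly in the coordinates of `β`. -/
theorem exists_norm_toContinuousLinearMap_le {n : ℕ}
    (B : (Fin n → ℂ) →ₗ[ℂ] (Fin n → ℂ) →ₗ[ℂ] ℂ) :
    ∃ M : ℝ, 0 ≤ M ∧ ∀ β : Fin n → ℤ,
      ‖LinearMap.toContinuousLinearMap (B (zc β))‖ ≤ M * ∑ i, |(β i : ℝ)| := by
  let L := fun i : Fin n => LinearMap.toContinuousLinearMap (B (Pi.single i 1))
  refine ⟨∑ i, ‖L i‖, Finset.sum_nonneg fun i _ => norm_nonneg _, fun β => ?_⟩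
  have h : LinearMap.toContinuousLinearMap (B (zc β)) = ∑ i, (β i : ℂ) • L i := by
    ext1 h
    have hz : zc β = ∑ i, (β i : ℂ) • (Pi.single i 1 : Fin n → ℂ) :=
      pi_eq_sum_univ' (zc β)
    simp [L, hz]
  rw [h, Finset.mul_sum]
  refine (norm_sum_le _ _).trans (Finset.sum_le_sum fun i _ => ?_)
  rw [norm_smul, Complex.norm_intCast, mul_comm]
  exact mul_le_mul_of_nonneg_right
    (Finset.single_le_sum (f := fun i => ‖L i‖) (fun j _ => norm_nonneg _) (Finset.mem_univ i))
    (abs_nonneg _)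

/-- For fixed `k ≥ 1` and `τ ∈ ℍ`, the theta function `h ↦ θ_k(τ, h)` is complex
differentiable (holomorphic) at every point of `ℂⁿ`. -/
theorem statement11 (n : ℕ) (hn : 1 ≤ n)
    (Bℝ : (Fin n → ℝ) →ₗ[ℝ] (Fin n → ℝ) →ₗ[ℝ] ℝ)
    (hsymm : ∀ x y : Fin n → ℝ, Bℝ x y = Bℝ y x)
    (hpos : ∀ x : Fin n → ℝ, x ≠ 0 → 0 < Bℝ x x)
    (hint : ∀ β γ : Fin n → ℤ, ∃ m : ℤ,
      Bℝ (fun i => (β i : ℝ)) (fun i => (γ i : ℝ)) = (m : ℝ))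
    (B : (Fin n → ℂ) →ₗ[ℂ] (Fin n → ℂ) →ₗ[ℂ] ℂ)
    (hext : ∀ x y : Fin n → ℝ, B (rc x) (rc y) = (Bℝ x y : ℂ))
    (k : ℤ) (hk : 1 ≤ k)
    (τ : ℂ) (hτ : 0 < τ.im) :
    Differentiable ℂ (fun h : Fin n → ℂ => theta B k τ h) := by
  obtain ⟨c, hc, hcQ⟩ := exists_pos_mul_sum_sq_le Bℝ hpos
  obtain ⟨M, hM, hML⟩ := exists_norm_toContinuousLinearMap_le B
  have hk0 : (0 : ℝ) < k := by exact_mod_cast hk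
  set a : ℂ := 2 * (Real.pi : ℂ) * Complex.I * (k : ℂ)
  let L : (Fin n → ℤ) → (Fin n → ℂ) →L[ℂ] ℂ := fun β =>
    a • LinearMap.toContinuousLinearMap (B (zc β))
  set N : ℝ := ‖a‖ * M
  have hN : 0 ≤ N := mul_nonneg (norm_nonneg _) hM
  have hL : ∀ β, ‖L β‖ ≤ N * ∑ i, |(β i : ℝ)| := fun β => by
    rw [norm_smul, mul_assoc]
    exact mul_le_mul_of_nonneg_left (hML β) (norm_nonneg _)
  set d : ℝ := Real.pi * k * τ.im
  have hd : 0 < d := by positivity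
  have hnorm : ∀ β h,
      ‖thetaTerm B k τ h β‖ ≤ Real.exp (‖L β‖ * ‖h‖ - d * c * ∑ i, (β i : ℝ) ^ 2) := by
    intro β h
    have hz : B (zc β) (zc β) = (Bℝ (fun i => (β i : ℝ)) (fun i => (β i : ℝ)) : ℂ) := by
      rw [← hext]
      rfl
    have hre : ((Real.pi : ℂ) * Complex.I * (k : ℂ) * τ * B (zc β) (zc β)).re
        = -(d * Bℝ (fun i => (β i : ℝ)) (fun i => (β i : ℝ))) := by
      simp [hz, d]
    have h1 : (L β h).re ≤ ‖L β‖ * ‖h‖ :=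
      (Complex.re_le_norm _).trans ((L β).le_opNorm h)
    have h2 := mul_le_mul_of_nonneg_left (hcQ fun i => (β i : ℝ)) hd.le
    have h3 : (a * B (zc β) h).re = (L β h).re := by simp [L]
    rw [thetaTerm, Complex.norm_exp, Complex.add_re, hre, h3]
    apply Real.exp_le_exp.2
    linarith
  have hderiv : ∀ β h, HasFDerivAt (fun h => thetaTerm B k τ h β)
      (thetaTerm B k τ h β • L β) h := fun β h =>
    ((L β).hasFDerivAt.add_const _).cexp
  intro h₀
  set R : ℝ := ‖h₀‖ + 1
  let u : (Fin n → ℤ) → ℝ := fun β =>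
    ∏ i, Real.exp (N * (R + 1) * |(β i : ℝ)| - d * c * (β i : ℝ) ^ 2)
  have hu : Summable u := summable_prod_apply (fun m : ℤ => (Real.exp_pos _).le)
    (summable_exp_linear_sub_sq (N * (R + 1)) (mul_pos hd hc)) n
  have hu_eq : ∀ β, u β = Real.exp (N * (∑ i, |(β i : ℝ)|) * R
      - d * c * ∑ i, (β i : ℝ) ^ 2) * Real.exp (N * ∑ i, |(β i : ℝ)|) := fun β => by
    simp only [u]
    rw [← Real.exp_add, ← Real.exp_sum, Finset.sum_sub_distrib, ← Finset.mul_sum,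
      ← Finset.mul_sum]
    congr 1
    ring
  have hball : ∀ β, ∀ h ∈ Metric.ball (0 : Fin n → ℂ) R, ‖thetaTerm B k τ h β‖ ≤
      Real.exp (N * (∑ i, |(β i : ℝ)|) * R - d * c * ∑ i, (β i : ℝ) ^ 2) := by
    intro β h hh
    refine (hnorm β h).trans (Real.exp_le_exp.2 (sub_le_sub_right ?_ _))
    exact mul_le_mul (hL β) (mem_ball_zero_iff.1 hh).le (norm_nonneg _) ((norm_nonneg _).trans (hL β))
  have hmem : h₀ ∈ Metric.ball (0 : Fin n → ℂ) R := by simp [R]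
  refine (hasFDerivAt_tsum_of_isPreconnected hu Metric.isOpen_ball
    (convex_ball (0 : Fin n → ℂ) R).isPreconnected (fun β h _ => hderiv β h) (fun β h hh => ?_)
    hmem (Summable.of_norm_bounded hu fun β => ?_) hmem).differentiableAt
  · rw [norm_smul, hu_eq]
    refine mul_le_mul (hball β h hh) ((hL β).trans ?_) (norm_nonneg _) (Real.exp_pos _).le
    linarith [Real.add_one_le_exp (N * ∑ i, |(β i : ℝ)|)]
  · rw [hu_eq]
    refine (hball β h₀ hmem).trans (le_mul_of_one_le_right (Real.exp_pos _).le ?_)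
    exact Real.one_le_exp (mul_nonneg hN (Finset.sum_nonneg fun i _ => abs_nonneg _))
end
end

section
/- Let n ≥ 1, let B be a symmetric bilinear form on ℝⁿ taking integer values on ℤⁿ with B(β, β) even for every β ∈ ℤⁿ (an even lattice), and let W be a subgroup of GL(n, ℤ) preserving B. Let SL(2, ℤ) act on ℤⁿ × ℤⁿ by A • (β₁, β₂) = (d·β₁ − c·β₂, a·β₂ − b·β₁) for A = !![a, b; c, d], commuting with the diagonal W-action, and form the semidirect product 𝒩₂ = (ℤⁿ × ℤⁿ) ⋊ (W × SL(2, ℤ)). Then the formulas (β₁, β₂) ∗ (τ, h, z) = (τ, h + τ·β₁ + β₂, z·exp(2πi·B(β₁, h) + πi·τ·B(β₁, β₁))), w ∗ (τ, h, z) = (τ, w(h), z), and A ∗ (τ, h, z) = ((aτ + b)/(cτ + d), h/(cτ + d), z·exp(−πi·(c/(cτ + d))·B(h, h))) together define a left group action of 𝒩₂ on ℍ × ℂⁿ × ℂ. -/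
noncomputable section

/-- The action of `w ∈ GL(n, ℤ)` on `ℂⁿ` by extension of scalars. -/
def glAct {n : ℕ} (w : Matrix.GeneralLinearGroup (Fin n) ℤ) (h : Fin n → ℂ) : Fin n → ℂ :=
  ((w : Matrix (Fin n) (Fin n) ℤ).map (fun a => (a : ℂ))).mulVec h

/-- The action of `w ∈ GL(n, ℤ)` on the lattice `ℤⁿ`. -/
def glActZ {n : ℕ} (w : Matrix.GeneralLinearGroup (Fin n) ℤ) (β : Fin n → ℤ) : Fin n → ℤ :=
  (w : Matrix (Fin n) (Fin n) ℤ).mulVec β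

/-- The action of `A = !![a, b; c, d] ∈ SL(2, ℤ)` on `ℤⁿ × ℤⁿ`:
`A • (β₁, β₂) = (d·β₁ − c·β₂, a·β₂ − b·β₁)`. -/
def sl2Lat {n : ℕ} (A : Matrix.SpecialLinearGroup (Fin 2) ℤ)
    (p : (Fin n → ℤ) × (Fin n → ℤ)) : (Fin n → ℤ) × (Fin n → ℤ) :=
  (A.1 1 1 • p.1 - A.1 1 0 • p.2, A.1 0 0 • p.2 - A.1 0 1 • p.1)

/-- The action of an element `((β₁, β₂), (w, A))` of `𝒩₂ = (ℤⁿ × ℤⁿ) ⋊ (W × SL(2, ℤ))` on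
the total space `ℍ × ℂⁿ × ℂ` of the line bundle `ℒ`, combining
`(β₁, β₂) ∗ (τ, h, z) = (τ, h + τ·β₁ + β₂, z·exp(2πi·B(β₁, h) + πi·τ·B(β₁, β₁)))`,
`w ∗ (τ, h, z) = (τ, w(h), z)`, and
`A ∗ (τ, h, z) = ((aτ + b)/(cτ + d), h/(cτ + d), z·exp(−πi·(c/(cτ + d))·B(h, h)))`. -/
def n2LineAct {n : ℕ} (B : (Fin n → ℂ) →ₗ[ℂ] (Fin n → ℂ) →ₗ[ℂ] ℂ)
    (g : ((Fin n → ℤ) × (Fin n → ℤ)) ×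
      (Matrix.GeneralLinearGroup (Fin n) ℤ × Matrix.SpecialLinearGroup (Fin 2) ℤ))
    (x : ℂ × (Fin n → ℂ) × ℂ) : ℂ × (Fin n → ℂ) × ℂ :=
  let den : ℂ := (g.2.2.1 1 0 : ℂ) * x.1 + (g.2.2.1 1 1 : ℂ)
  let τ' : ℂ := ((g.2.2.1 0 0 : ℂ) * x.1 + (g.2.2.1 0 1 : ℂ)) / den
  let h' : Fin n → ℂ := glAct g.2.1 (den⁻¹ • x.2.1)
  (τ', h' + τ' • zc g.1.1 + zc g.1.2,
   x.2.2 * Complex.exp (-(Real.pi : ℂ) * Complex.I * ((g.2.2.1 1 0 : ℂ) / den)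
        * B x.2.1 x.2.1)
      * Complex.exp (2 * (Real.pi : ℂ) * Complex.I * B (zc g.1.1) h'
        + (Real.pi : ℂ) * Complex.I * τ' * B (zc g.1.1) (zc g.1.1)))

theorem zc_add {n : ℕ} (β γ : Fin n → ℤ) : zc (β + γ) = zc β + zc γ := by
  ext i; simp [zc]

theorem zc_sub {n : ℕ} (β γ : Fin n → ℤ) : zc (β - γ) = zc β - zc γ := by
  ext i; simp [zc]

theorem zc_zsmul {n : ℕ} (k : ℤ) (β : Fin n → ℤ) : zc (k • β) = (k : ℂ) • zc β := by
  ext i; simp [zc]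

theorem zc_zero {n : ℕ} : zc (0 : Fin n → ℤ) = 0 := by
  ext i; simp [zc]

section GeneralLinear

variable {n : ℕ} (w v : Matrix.GeneralLinearGroup (Fin n) ℤ)

theorem zc_glActZ (β : Fin n → ℤ) : zc (glActZ w β) = glAct w (zc β) := by
  ext i; simp [zc, glActZ, glAct, Matrix.mulVec, dotProduct]

theorem glAct_add (x y : Fin n → ℂ) : glAct w (x + y) = glAct w x + glAct w y :=
  Matrix.mulVec_add _ _ _

theorem glAct_sub (x y : Fin n → ℂ) : glAct w (x - y) = glAct w x - glAct w y :=
  Matrix.mulVec_sub _ _ _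

theorem glAct_smul (k : ℂ) (x : Fin n → ℂ) : glAct w (k • x) = k • glAct w x :=
  Matrix.mulVec_smul _ _ _

theorem glAct_one (x : Fin n → ℂ) :
    glAct (1 : Matrix.GeneralLinearGroup (Fin n) ℤ) x = x := by
  simp [glAct]

theorem glAct_mul (x : Fin n → ℂ) : glAct (w * v) x = glAct w (glAct v x) := by
  have := Matrix.map_mul (L := (w : Matrix (Fin n) (Fin n) ℤ))
    (M := (v : Matrix (Fin n) (Fin n) ℤ)) (f := Int.castRingHom ℂ)
  simp only [glAct, Matrix.mulVec_mulVec, Units.val_mul]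
  exact congrArg (fun M => Matrix.mulVec M x) this

end GeneralLinear

section Moebius

variable (A : Matrix.SpecialLinearGroup (Fin 2) ℤ) {τ : ℂ}

theorem sl2_det_cast :
    (A.1 0 0 : ℂ) * (A.1 1 1 : ℂ) - (A.1 0 1 : ℂ) * (A.1 1 0 : ℂ) = 1 := by
  have h := A.2
  rw [Matrix.det_fin_two] at h
  exact_mod_cast h

theorem moebius_denom_ne_zero (hτ : 0 < τ.im) : (A.1 1 0 : ℂ) * τ + (A.1 1 1 : ℂ) ≠ 0 := by
  have h := UpperHalfPlane.denom_ne_zero (A : GL (Fin 2) ℝ) ⟨τ, hτ⟩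
  simpa [UpperHalfPlane.denom] using h

theorem moebius_im_pos (hτ : 0 < τ.im) :
    0 < (((A.1 0 0 : ℂ) * τ + (A.1 0 1 : ℂ)) / ((A.1 1 0 : ℂ) * τ + (A.1 1 1 : ℂ))).im := by
  have h := (A • (⟨τ, hτ⟩ : UpperHalfPlane)).im_pos
  rw [← UpperHalfPlane.coe_im, UpperHalfPlane.coe_specialLinearGroup_apply] at h
  simpa using h

end Moebius

/-- The exponents of the automorphy factors, divided by `πi`, satisfy the cocycle identity up to
an explicit integral correction. The variables `s, t₁, t₂, r, kᵢⱼ, lᵢ, p` are the values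
`B(H, H), B(Q₁, H), B(Q₂, H), B(P, H), B(Qᵢ, Qⱼ), B(P, Qᵢ), B(P, P)`. -/
theorem exponent_cocycle {a b c d a' b' c' d' τ e σ D s t₁ t₂ r k₁₁ k₁₂ k₂₂ l₁ l₂ p : ℂ}
    (he : e ≠ 0) (hD : D ≠ 0) (hdet : a * d - b * c = 1) (hdet' : a' * d' - b' * c' = 1)
    (e_eq : e = c' * τ + d') (hσ : σ * e = a' * τ + b') (D_eq : D = c * σ + d) :
    -((c * a' + d * c') / (D * e)) * (e ^ 2 * s)
        + 2 * D⁻¹ * (r + d * t₁ - c * t₂)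
        + (a * σ + b) / D * (p + 2 * (d * l₁ - c * l₂)
            + (d ^ 2 * k₁₁ - 2 * c * d * k₁₂ + c ^ 2 * k₂₂))
      = -(c' / e) * (e ^ 2 * s) + 2 * t₁ + σ * k₁₁
        + -(c / D) * (s + σ ^ 2 * k₁₁ + k₂₂ + 2 * σ * t₁ + 2 * t₂ + 2 * σ * k₁₂)
        + 2 * D⁻¹ * (r + σ * l₁ + l₂) + (a * σ + b) / D * p
        + (b * d * k₁₁ - 2 * (b * c) * k₁₂ + a * c * k₂₂ + 2 * (b * l₁ - a * l₂)) := by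
  have hc : (c * a' + d * c') * e = c' * e * D + c := by
    rw [D_eq]; linear_combination (c * a') * e_eq - c * c' * hσ + c * hdet'
  have hs : (c * a' + d * c') / (D * e) * (e ^ 2 * s) = (c' * e + c / D) * s := by
    field_simp
    linear_combination s * hc
  have hs' : c' / e * (e ^ 2 * s) = c' * e * s := by field_simp
  rw [neg_mul, neg_mul, hs, hs']
  field_simp
  subst D_eq
  linear_combination (2 * σ * l₁ + 2 * l₂ + d * σ * k₁₁ - 2 * c * σ * k₁₂ - c * k₂₂) * hdet

/-- For an even lattice: if the symmetric ℂ-bilinear form `B` takes integer values on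
`ℤⁿ × ℤⁿ` and even values on the diagonal, and is preserved by `W ≤ GL(n, ℤ)`, then the
displayed formulas define a left action of `𝒩₂ = (ℤⁿ × ℤⁿ) ⋊ (W × SL(2, ℤ))` on
`ℍ × ℂⁿ × ℂ`: the identity acts trivially, the upper half plane is preserved, and the
action is compatible with the semidirect product multiplication
`(p, (w, A))·(q, (v, B)) = (p + w·(A • q), (w v, A B))`. -/
theorem statement17 (n : ℕ) (hn : 1 ≤ n)
    (W : Subgroup (Matrix.GeneralLinearGroup (Fin n) ℤ))
    (B : (Fin n → ℂ) →ₗ[ℂ] (Fin n → ℂ) →ₗ[ℂ] ℂ)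
    (hsymm : ∀ x y : Fin n → ℂ, B x y = B y x)
    (hint : ∀ β γ : Fin n → ℤ, ∃ m : ℤ, B (zc β) (zc γ) = (m : ℂ))
    (heven : ∀ β : Fin n → ℤ, ∃ m : ℤ, B (zc β) (zc β) = (2 * m : ℂ))
    (hW : ∀ w : Matrix.GeneralLinearGroup (Fin n) ℤ, w ∈ W →
      ∀ x y : Fin n → ℂ, B (glAct w x) (glAct w y) = B x y) :
    (∀ x : ℂ × (Fin n → ℂ) × ℂ, 0 < x.1.im → n2LineAct B ((0, 0), (1, 1)) x = x) ∧
    (∀ g : ((Fin n → ℤ) × (Fin n → ℤ)) ×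
        (Matrix.GeneralLinearGroup (Fin n) ℤ × Matrix.SpecialLinearGroup (Fin 2) ℤ),
      g.2.1 ∈ W → ∀ x : ℂ × (Fin n → ℂ) × ℂ, 0 < x.1.im → 0 < (n2LineAct B g x).1.im) ∧
    (∀ (p q : (Fin n → ℤ) × (Fin n → ℤ)) (w v : Matrix.GeneralLinearGroup (Fin n) ℤ)
        (A A' : Matrix.SpecialLinearGroup (Fin 2) ℤ), w ∈ W → v ∈ W →
      ∀ x : ℂ × (Fin n → ℂ) × ℂ, 0 < x.1.im →
        n2LineAct B ((p.1 + glActZ w (sl2Lat A q).1, p.2 + glActZ w (sl2Lat A q).2),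
                     (w * v, A * A')) x
          = n2LineAct B (p, (w, A)) (n2LineAct B (q, (v, A')) x)) := by
  refine ⟨fun x _ => ?_, fun g _ x hx => moebius_im_pos g.2.2 hx, ?_⟩
  · obtain ⟨τ, h, z⟩ := x
    simp [n2LineAct, zc_zero, glAct_one]
  rintro ⟨p₁, p₂⟩ ⟨q₁, q₂⟩ w v A A' hw hv ⟨τ, h, z⟩ hτ
  have he := moebius_denom_ne_zero A' hτ
  have hD := moebius_denom_ne_zero A (moebius_im_pos A' hτ)
  have hdet := sl2_det_cast A
  have hdet' := sl2_det_cast A'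
  obtain ⟨k₁₁, hk₁₁⟩ := heven q₁
  obtain ⟨k₂₂, hk₂₂⟩ := heven q₂
  obtain ⟨k₁₂, hk₁₂⟩ := hint q₁ q₂
  obtain ⟨l₁, hl₁⟩ := hint p₁ (glActZ w q₁)
  obtain ⟨l₂, hl₂⟩ := hint p₁ (glActZ w q₂)
  simp only [zc_glActZ] at hl₁ hl₂
  simp only [n2LineAct, sl2Lat, Matrix.SpecialLinearGroup.coe_mul, Matrix.mul_apply,
    Fin.sum_univ_two, Int.cast_add, Int.cast_mul, zc_add, zc_glActZ, zc_sub, zc_zsmul,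
    glAct_add, glAct_sub, glAct_smul, glAct_mul]
  simp only at he hD hτ
  generalize (A.1 0 0) = a at *
  generalize (A.1 0 1) = b at *
  generalize (A.1 1 0) = c at *
  generalize (A.1 1 1) = d at *
  generalize (A'.1 0 0) = a' at *
  generalize (A'.1 0 1) = b' at *
  generalize (A'.1 1 0) = c' at *
  generalize (A'.1 1 1) = d' at *
  generalize he_eq : (c' : ℂ) * τ + d' = e at *
  have hσ : ((a' : ℂ) * τ + b') / e * e = a' * τ + b' := div_mul_cancel₀ _ he
  generalize ((a' : ℂ) * τ + b') / e = σ at *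
  generalize hD_eq : (c : ℂ) * σ + d = D at *
  have hden : ((c : ℂ) * a' + d * c') * τ + (c * b' + d * d') = D * e := by
    rw [← hD_eq, ← he_eq]; rw [← he_eq] at hσ; linear_combination -c * hσ
  have hnum : ((a : ℂ) * a' + b * c') * τ + (a * b' + b * d') = (a * σ + b) * e := by
    rw [← he_eq]; rw [← he_eq] at hσ; linear_combination -a * hσ
  rw [hden, hnum, mul_div_mul_right _ _ he]
  obtain ⟨u, rfl⟩ : ∃ u, h = e • u := ⟨e⁻¹ • h, (smul_inv_smul₀ he h).symm⟩
  have hinv : (D * e)⁻¹ * e = D⁻¹ := by field_simp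
  have hinv' : e⁻¹ * e = 1 := inv_mul_cancel₀ he
  simp only [glAct_smul, smul_smul, hinv, hinv', one_smul]
  refine Prod.ext rfl (Prod.ext ?_ ?_)
  · ext i
    simp only [Pi.add_apply, Pi.sub_apply, Pi.smul_apply, smul_eq_mul]
    field_simp
    rw [← hD_eq]
    linear_combination (σ * glAct w (zc q₁) i + glAct w (zc q₂) i) * hdet
  · simp only [mul_assoc, ← Complex.exp_add]
    congr 1
    rw [Complex.exp_eq_exp_iff_exists_int]
    refine ⟨b * d * k₁₁ - b * c * k₁₂ + a * c * k₂₂ + (b * l₁ - a * l₂), ?_⟩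
    simp only [map_add, map_sub, map_smul, LinearMap.add_apply, LinearMap.sub_apply,
      LinearMap.smul_apply, smul_eq_mul, hW w hw, hW v hv, hsymm (glAct w _) (zc p₁),
      hsymm (glAct v u) (zc _), hsymm (zc q₂) (zc q₁), hk₁₁, hk₁₂, hk₂₂, hl₁, hl₂]
    have key := exponent_cocycle (s := B u u) (t₁ := B (zc q₁) (glAct v u))
      (t₂ := B (zc q₂) (glAct v u)) (r := B (zc p₁) (glAct w (glAct v u)))
      (k₁₁ := 2 * k₁₁) (k₁₂ := k₁₂) (k₂₂ := 2 * k₂₂) (l₁ := l₁) (l₂ := l₂)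
      (p := B (zc p₁) (zc p₁)) he hD hdet hdet' he_eq.symm hσ hD_eq.symm
    push_cast
    linear_combination (Real.pi * Complex.I : ℂ) * key
end
end
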